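/- arXiv:1805.07804 — 6 statements merged into one kernel-verified Lean document; each statement's English description precedes it below -/
import Mathlib

section
/- Let x > 1 and 0 < y < 1. Then B(x,y) < (x + y - xy)/(xy). -/
open MeasureTheory

/-- The real Beta function, `B(x,y) = ∫_0^1 t^(x-1) (1-t)^(y-1) dt`. -/
noncomputable def realBeta (x y : ℝ) : ℝ :=
  ∫ t in (0:ℝ)..1, t ^ (x - 1) * (1 - t) ^ (y - 1)

theorem beta_lt (x y : ℝ) (hx : 1 < x) (hy0 : 0 < y) (hy1 : y < 1) :
    realBeta x y < (x + y - x * y) / (x * y) := by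
  have hf_cont : Continuous fun t : ℝ => t ^ (x - 1) :=
    Real.continuous_rpow_const (by linarith)
  have hf : IntervalIntegrable (fun t : ℝ => t ^ (x - 1)) volume 0 1 :=
    hf_cont.intervalIntegrable 0 1
  have hg : IntervalIntegrable (fun t : ℝ => (1 - t) ^ (y - 1)) volume 0 1 := by
    have h := (intervalIntegral.intervalIntegrable_rpow' (a := 0) (b := 1)
      (r := y - 1) (by linarith)).comp_sub_left 1
    simpa using h.symm
  have hfg : IntervalIntegrable (fun t : ℝ => t ^ (x - 1) * (1 - t) ^ (y - 1)) volume 0 1 :=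
    hg.continuousOn_mul hf_cont.continuousOn
  have hfg_add : IntervalIntegrable (fun t : ℝ => t ^ (x - 1) + (1 - t) ^ (y - 1)) volume 0 1 :=
    hf.add hg
  have hone : IntervalIntegrable (fun _ : ℝ => (1 : ℝ)) volume 0 1 :=
    intervalIntegrable_const
  have hf_int : ∫ t in (0 : ℝ)..1, t ^ (x - 1) = 1 / x := by
    rw [integral_rpow (Or.inl (by linarith)), sub_add_cancel, Real.one_rpow,
      Real.zero_rpow (by linarith), sub_zero]
  have hg_int : ∫ t in (0 : ℝ)..1, (1 - t) ^ (y - 1) = 1 / y := by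
    rw [intervalIntegral.integral_comp_sub_left (fun t : ℝ => t ^ (y - 1)), sub_self, sub_zero,
      integral_rpow (Or.inl (by linarith)), sub_add_cancel, Real.one_rpow,
      Real.zero_rpow hy0.ne', sub_zero]
  have hpos : 0 < ∫ t in (0 : ℝ)..1,
      (t ^ (x - 1) + (1 - t) ^ (y - 1) - 1 - t ^ (x - 1) * (1 - t) ^ (y - 1)) := by
    refine intervalIntegral.intervalIntegral_pos_of_pos_on ((hfg_add.sub hone).sub hfg) ?_
      one_pos
    intro t ht
    have hlt : t ^ (x - 1) < 1 := Real.rpow_lt_one ht.1.le ht.2 (by linarith)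
    have hgt : 1 < (1 - t) ^ (y - 1) :=
      Real.one_lt_rpow_of_pos_of_lt_one_of_neg (by linarith [ht.2]) (by linarith [ht.1])
        (by linarith)
    nlinarith [mul_pos (sub_pos.2 hlt) (sub_pos.2 hgt)]
  rw [intervalIntegral.integral_sub (hfg_add.sub hone) hfg,
    intervalIntegral.integral_sub hfg_add hone, intervalIntegral.integral_add hf hg,
    hf_int, hg_int, intervalIntegral.integral_const] at hpos
  have hrhs : (x + y - x * y) / (x * y) = 1 / x + 1 / y - 1 := by
    have : x ≠ 0 := by linarith
    field_simp
    ring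
  rw [hrhs, realBeta]
  simpa using hpos
end

section
/- Let x > 1 and 0 < y < 1. Then ψ(1+x) - ψ(x+y) < (1-y)/(x + y - xy), where ψ(x) = Γ'(x)/Γ(x) is the digamma function. -/
/-- The digamma function `ψ(x) = Γ'(x)/Γ(x)`. -/
noncomputable def digamma (x : ℝ) : ℝ := deriv Real.Gamma x / Real.Gamma x

theorem Real.differentiableAt_Gamma_of_pos {x : ℝ} (hx : 0 < x) :
    DifferentiableAt ℝ Real.Gamma x :=
  Real.differentiableAt_Gamma fun m => by
    have : (0 : ℝ) ≤ m := m.cast_nonneg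
    linarith

theorem digamma_add_one {x : ℝ} (hx : 0 < x) : digamma (x + 1) = digamma x + 1 / x := by
  have hd : DifferentiableAt ℝ Real.Gamma x :=
    Real.differentiableAt_Gamma_of_pos hx
  have hderiv : deriv Real.Gamma (x + 1) = Real.Gamma x + x * deriv Real.Gamma x := by
    rw [← deriv_comp_add_const]
    have heq : (fun z => Real.Gamma (z + 1)) =ᶠ[nhds x] fun z => z * Real.Gamma z := by
      filter_upwards [lt_mem_nhds hx] with z hz using Real.Gamma_add_one hz.ne'
    rw [heq.deriv_eq]
    simpa using ((hasDerivAt_id' x).fun_mul hd.hasDerivAt).deriv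
  have hG := (Real.Gamma_pos_of_pos hx).ne'
  rw [digamma, digamma, hderiv, Real.Gamma_add_one hx.ne']
  field_simp
  ring

theorem monotoneOn_digamma : MonotoneOn digamma (Set.Ioi 0) := by
  have hd : ∀ x ∈ Set.Ioi (0 : ℝ), DifferentiableAt ℝ Real.Gamma x := fun x hx =>
    Real.differentiableAt_Gamma_of_pos hx
  have hm := Real.convexOn_log_Gamma.monotoneOn_deriv fun x hx =>
    ((hd x hx).log (Real.Gamma_pos_of_pos hx).ne' : DifferentiableAt ℝ (Real.log ∘ Real.Gamma) x)
  refine hm.congr fun x hx => ?_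
  exact deriv.log (hd x hx) (Real.Gamma_pos_of_pos hx).ne'

theorem digamma_add_one_sub_le {x y : ℝ} (hx : 0 < x) (hy0 : 0 ≤ y) (hy1 : y ≤ 1) :
    digamma (x + 1) - digamma (x + y) ≤ (1 - y) / x := by
  set g : ℝ → ℝ := fun z => (1 - y) / z - (digamma (z + 1) - digamma (z + y)) with hg
  have hstep : ∀ z, 0 < z → g (z + 1) ≤ g z := by
    intro z hz
    have h1 := digamma_add_one (x := z + 1) (by linarith)
    have h2 := digamma_add_one (x := z + y) (by linarith)
    have h3 : 1 / (z + y) - 1 / (z + 1) ≤ (1 - y) / z - (1 - y) / (z + 1) := by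
      have e1 : 1 / (z + y) - 1 / (z + 1) = (1 - y) / ((z + y) * (z + 1)) := by
        field_simp
        ring
      have e2 : (1 - y) / z - (1 - y) / (z + 1) = (1 - y) / (z * (z + 1)) := by
        field_simp
        ring
      rw [e1, e2]
      gcongr; linarith
    simp only [hg, h1, show z + 1 + y = z + y + 1 by ring, h2]
    linarith
  have hiter : ∀ n : ℕ, g (x + n) ≤ g x := by
    intro n
    induction n with
    | zero => simp
    | succ n ih =>
      have := hstep (x + n) (by positivity)
      push_cast
      rw [← add_assoc]
      exact this.trans ih
  have hlower : ∀ z, 0 < z → -(1 / z) ≤ g z := by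
    intro z hz
    have h1 := digamma_add_one hz
    have h2 : digamma z ≤ digamma (z + y) :=
      monotoneOn_digamma hz (show 0 < z + y by linarith) (by linarith)
    have h3 : 0 ≤ (1 - y) / z := div_nonneg (by linarith) hz.le
    simp only [hg]
    linarith
  have hlim : Filter.Tendsto (fun n : ℕ => -(1 / (x + n))) Filter.atTop (nhds 0) := by
    have h : Filter.Tendsto (fun n : ℕ => x + (n : ℝ)) Filter.atTop Filter.atTop :=
      Filter.tendsto_atTop_add_const_left _ _ tendsto_natCast_atTop_atTop
    simpa using h.inv_tendsto_atTop.neg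
  have h0 : 0 ≤ g x := le_of_tendsto' hlim fun n =>
    (hlower (x + n) (by positivity)).trans (hiter n)
  exact sub_nonneg.1 h0

theorem digamma_diff_lt (x y : ℝ) (hx : 1 < x) (hy0 : 0 < y) (hy1 : y < 1) :
    digamma (1 + x) - digamma (x + y) < (1 - y) / (x + y - x * y) := by
  have h := digamma_add_one_sub_le (x := x) (by linarith) hy0.le hy1.le
  rw [add_comm 1 x]
  refine h.trans_lt (div_lt_div_of_pos_left (by linarith) ?_ ?_) <;> nlinarith
end

section
/- Let 2 < p < 4. Then B(2/p, 2(p-2)) ≤ 1/((p-2)(4-p)). -/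
open MeasureTheory

lemma ofReal_betaIntegrand (x y : ℝ) {t : ℝ} (ht : t ∈ Set.Icc (0 : ℝ) 1) :
    (t : ℂ) ^ ((x : ℂ) - 1) * (1 - (t : ℂ)) ^ ((y : ℂ) - 1)
      = ((t ^ (x - 1) * (1 - t) ^ (y - 1) : ℝ) : ℂ) := by
  rw [Complex.ofReal_mul, Complex.ofReal_cpow ht.1, Complex.ofReal_cpow (sub_nonneg.2 ht.2)]
  push_cast
  rfl

lemma intervalIntegrable_betaIntegrand {x y : ℝ} (hx : 0 < x) (hy : 0 < y) :
    IntervalIntegrable (fun t : ℝ => t ^ (x - 1) * (1 - t) ^ (y - 1)) volume 0 1 := by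
  have h := Complex.betaIntegral_convergent (u := x) (v := y) (by simpa) (by simpa)
  rw [intervalIntegrable_iff_integrableOn_Ioc_of_le zero_le_one] at h ⊢
  refine IntegrableOn.congr_fun h.re (fun t ht => ?_) measurableSet_Ioc
  simp only [ofReal_betaIntegrand x y (Set.Ioc_subset_Icc_self ht)]
  exact Complex.ofReal_re _

lemma realBeta_eq_Gamma {x y : ℝ} (hx : 0 < x) (hy : 0 < y) :
    realBeta x y = Real.Gamma x * Real.Gamma y / Real.Gamma (x + y) := by
  have h : Complex.betaIntegral x y = (realBeta x y : ℂ) := by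
    rw [Complex.betaIntegral, realBeta, ← intervalIntegral.integral_ofReal]
    refine intervalIntegral.integral_congr fun t ht => ?_
    rw [Set.uIcc_of_le zero_le_one] at ht
    exact ofReal_betaIntegrand x y ht
  have h' := ProbabilityTheory.beta_eq_betaIntegralReal x y hx hy
  rw [h, Complex.ofReal_re] at h'
  exact h'.symm

lemma realBeta_one {x : ℝ} (hx : 0 < x) : realBeta x 1 = 1 / x := by
  rw [realBeta_eq_Gamma hx one_pos, Real.Gamma_add_one hx.ne', Real.Gamma_one]
  have := (Real.Gamma_pos_of_pos hx).ne'
  field_simp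

lemma realBeta_eq_mul_realBeta_add_one {x y : ℝ} (hx : 0 < x) (hy : 0 < y) :
    realBeta x y = (x + y) / y * realBeta x (y + 1) := by
  rw [realBeta_eq_Gamma hx hy, realBeta_eq_Gamma hx (by linarith), ← add_assoc,
    Real.Gamma_add_one hy.ne', Real.Gamma_add_one (add_pos hx hy).ne']
  have := (Real.Gamma_pos_of_pos (add_pos hx hy)).ne'
  have : x + y ≠ 0 := by positivity
  field_simp

lemma realBeta_two {x : ℝ} (hx : 0 < x) : realBeta x 2 = 1 / (x * (x + 1)) := by
  have h := realBeta_eq_mul_realBeta_add_one hx one_pos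
  rw [realBeta_one hx, one_add_one_eq_two] at h
  field_simp at h ⊢
  linarith

lemma realBeta_three {x : ℝ} (hx : 0 < x) :
    realBeta x 3 = 2 / (x * (x + 1) * (x + 2)) := by
  have h := realBeta_eq_mul_realBeta_add_one hx two_pos
  rw [realBeta_two hx, two_add_one_eq_three] at h
  field_simp at h ⊢
  linarith

/-- The Beta function is antitone in its second argument. -/
lemma realBeta_le_realBeta {x y z : ℝ} (hx : 0 < x) (hy : 0 < y) (hyz : y ≤ z) :
    realBeta x z ≤ realBeta x y := by
  refine intervalIntegral.integral_mono_on_of_le_Ioo zero_le_one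
    (intervalIntegrable_betaIntegrand hx (hy.trans_le hyz))
    (intervalIntegrable_betaIntegrand hx hy) fun t ht => ?_
  have ht0 := ht.1
  refine mul_le_mul_of_nonneg_left ?_ (by positivity)
  exact Real.rpow_le_rpow_of_exponent_ge (sub_pos.2 ht.2) (by linarith) (by linarith)

/-- The Beta function is convex in its second argument. -/
lemma realBeta_convex_combination_le {x y z a b : ℝ} (hx : 0 < x) (hy : 0 < y) (hz : 0 < z)
    (ha : 0 ≤ a) (hb : 0 ≤ b) (hab : a + b = 1) :
    realBeta x (a * y + b * z) ≤ a * realBeta x y + b * realBeta x z := by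
  have iy := (intervalIntegrable_betaIntegrand hx hy).const_mul a
  have iz := (intervalIntegrable_betaIntegrand hx hz).const_mul b
  have hpos : 0 < a * y + b * z := convex_Ioi (0 : ℝ) hy hz ha hb hab
  unfold realBeta
  rw [← intervalIntegral.integral_const_mul, ← intervalIntegral.integral_const_mul,
    ← intervalIntegral.integral_add iy iz]
  refine intervalIntegral.integral_mono_on_of_le_Ioo zero_le_one
    (intervalIntegrable_betaIntegrand hx hpos) (iy.add iz) fun t ht => ?_
  have ht0 := ht.1
  have ht1 : 0 < 1 - t := sub_pos.2 ht.2
  have hexp : a * y + b * z - 1 = (y - 1) * a + (z - 1) * b := by linear_combination hab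
  have h := Real.geom_mean_le_arith_mean2_weighted ha hb
    (Real.rpow_nonneg ht1.le (y - 1)) (Real.rpow_nonneg ht1.le (z - 1)) hab
  rw [← Real.rpow_mul ht1.le, ← Real.rpow_mul ht1.le, ← Real.rpow_add ht1, ← hexp] at h
  have h' := mul_le_mul_of_nonneg_left h (Real.rpow_nonneg ht0.le (x - 1))
  linarith

lemma realBeta_two_add_le {x s : ℝ} (hx : 0 < x) (hs0 : 0 ≤ s) (hs1 : s ≤ 1) :
    realBeta x (2 + s) ≤ (x + 2 - x * s) / (x * (x + 1) * (x + 2)) := by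
  have h := realBeta_convex_combination_le hx two_pos three_pos (sub_nonneg.2 hs1) hs0
    (sub_add_cancel 1 s)
  rw [realBeta_two hx, realBeta_three hx] at h
  convert h using 1
  · ring_nf
  · field_simp
    ring

theorem beta_le (p : ℝ) (hp2 : 2 < p) (hp4 : p < 4) :
    realBeta (2 / p) (2 * (p - 2)) ≤ 1 / ((p - 2) * (4 - p)) := by
  obtain ⟨e, rfl⟩ : ∃ e, p = e + 2 := ⟨p - 2, by ring⟩
  have he0 : 0 < e := by linarith
  have he2 : 0 < 2 - e := by linarith
  have hx : 0 < 2 / (e + 2) := by positivity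
  rw [add_sub_cancel_right, show 4 - (e + 2) = 2 - e by ring]
  rcases le_total 1 e with h1 | h1
  · refine (realBeta_le_realBeta hx two_pos (by linarith)).trans ?_
    rw [realBeta_two hx, div_le_div_iff₀ (by positivity) (by positivity)]
    field_simp
    nlinarith [sq_nonneg (e ^ 2 + e - 2.64), sq_nonneg (e - 1.28)]
  have hy : 0 < 2 * e := by positivity
  rw [realBeta_eq_mul_realBeta_add_one hx hy]
  rcases le_total (1 / 2) e with h2 | h2
  · have h := realBeta_two_add_le hx (s := 2 * e - 1) (by linarith) (by linarith)
    rw [show 2 + (2 * e - 1) = 2 * e + 1 by ring] at h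
    refine (mul_le_mul_of_nonneg_left h (by positivity)).trans ?_
    rw [div_mul_div_comm, div_le_div_iff₀ (by positivity) (by positivity)]
    field_simp
    rw [← sub_nonneg]
    ring_nf
    nlinarith [mul_nonneg (pow_pos he0 4).le (sub_nonneg.2 h1), pow_pos he0 4,
      mul_nonneg he0.le (sq_nonneg (e - 0.7)), sq_nonneg (e - 0.7235)]
  · have h := realBeta_two_add_le hx (s := 2 * e) (by linarith) (by linarith)
    rw [realBeta_eq_mul_realBeta_add_one hx (by positivity),
      show 2 * e + 1 + 1 = 2 + 2 * e by ring, ← mul_assoc]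
    refine (mul_le_mul_of_nonneg_left h (by positivity)).trans ?_
    rw [div_mul_div_comm, div_mul_div_comm, div_le_div_iff₀ (by positivity) (by positivity)]
    field_simp
    rw [← sub_nonneg]
    ring_nf
    nlinarith [mul_nonneg he0.le (sub_nonneg.2 h2), mul_nonneg (pow_pos he0 5).le (sub_nonneg.2 h2),
      pow_pos he0 3, pow_pos he0 4]
end

section
/- Let 2 + √3 ≤ p < 4 and let 0 ≤ t < s < 1. Then s^{p(4-p)}·(1 - t) ≥ s - t. (Equivalently, the function H_{p,s}(t) = s^{8-2p}(s-t)^{-2/p} - (1-t)^{-2/p} is nonnegative on [0,s).) -/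
theorem H_nonneg (p s t : ℝ) (hp1 : 2 + Real.sqrt 3 ≤ p) (hp4 : p < 4)
    (ht0 : 0 ≤ t) (hts : t < s) (hs1 : s < 1) :
    s ^ (p * (4 - p)) * (1 - t) ≥ s - t := by
  have hexp : p * (4 - p) ≤ 1 := by
    nlinarith [Real.sq_sqrt (show (0 : ℝ) ≤ 3 by norm_num), Real.sqrt_nonneg 3]
  have hpow : s ≤ s ^ (p * (4 - p)) := by
    simpa using Real.rpow_le_rpow_of_exponent_ge (ht0.trans_lt hts) hs1.le hexp
  nlinarith [mul_le_mul_of_nonneg_right hpow (show 0 ≤ 1 - t by linarith),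
    mul_nonneg ht0 (show 0 ≤ 1 - s by linarith)]
end

section
/- Let 0 < α < 1 and z ∈ 𝔻. Then ∫_0^1 ω_t(z) · (1 - φ_t(z))^{-α} dt = ( ∫_0^1 (1 - sz)^{α-1} s^{-α} ds ) · (1 - z)^{-α}, where all complex powers are principal branch powers. In other words, 𝓗(f_α)(z) = ψ_α(z) · f_α(z) with f_α(z) = (1-z)^{-α} and ψ_α(z) = ∫_0^1 (1 - sz)^{α-1} s^{-α} ds. -/
/-- The weight `ω_t(z) = 1/((t-1)z+1)`. -/
noncomputable def omegaT (t : ℝ) (z : ℂ) : ℂ := 1 / (((t:ℂ) - 1) * z + 1)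

/-- The symbol `φ_t(z) = t/((t-1)z+1)`. -/
noncomputable def phiT (t : ℝ) (z : ℂ) : ℂ := (t:ℂ) / (((t:ℂ) - 1) * z + 1)

/-- A positive real factor can be pulled out of a principal power. -/
lemma ofReal_mul_cpow {r : ℝ} (hr : 0 < r) {x : ℂ} (hx : x ≠ 0) (c : ℂ) :
    ((r : ℂ) * x) ^ c = (r : ℂ) ^ c * x ^ c := by
  have hr' : (r : ℂ) ≠ 0 := Complex.ofReal_ne_zero.mpr hr.ne'
  rw [Complex.cpow_def_of_ne_zero (mul_ne_zero hr' hx), Complex.cpow_def_of_ne_zero hr',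
    Complex.cpow_def_of_ne_zero hx, Complex.log_ofReal_mul hr hx, Complex.ofReal_log hr.le,
    add_mul, Complex.exp_add]

/-- Principal powers are multiplicative on quotients of points in the right half-plane. -/
lemma div_cpow_of_re_pos {x y : ℂ} (hx : 0 < x.re) (hy : 0 < y.re) (c : ℂ) :
    (x / y) ^ c = x ^ c * y ^ (-c) := by
  have hx0 : x ≠ 0 := by rintro rfl; simp at hx
  have hy0 : y ≠ 0 := by rintro rfl; simp at hy
  have ax := abs_lt.mp (Complex.abs_arg_lt_pi_div_two_iff.mpr (Or.inl hx))
  have ay := abs_lt.mp (Complex.abs_arg_lt_pi_div_two_iff.mpr (Or.inl hy))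
  have hyπ : y.arg ≠ Real.pi := (by linarith [Real.pi_pos, ay.2] : y.arg < Real.pi).ne
  have hlog : Complex.log (x * y⁻¹) = Complex.log x - Complex.log y := by
    rw [(Complex.log_mul_eq_add_log_iff hx0 (inv_ne_zero hy0)).mpr, Complex.log_inv y hyπ,
      sub_eq_add_neg]
    rw [Complex.arg_inv, if_neg hyπ]
    constructor <;> linarith [ax.1, ax.2, ay.1, ay.2]
  rw [div_eq_mul_inv, Complex.cpow_def_of_ne_zero (mul_ne_zero hx0 (inv_ne_zero hy0)),
    Complex.cpow_def_of_ne_zero hx0, Complex.cpow_def_of_ne_zero hy0, hlog, ← Complex.exp_add]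
  congr 1
  ring

/-- After reflecting `t = 1 - s`, the two integrands agree pointwise. -/
lemma omegaT_mul_one_sub_phiT_cpow {z : ℂ} (hz : ‖z‖ < 1) {s : ℝ} (hs0 : 0 < s) (hs1 : s < 1)
    (c : ℂ) :
    omegaT (1 - s) z * (1 - phiT (1 - s) z) ^ (-c)
      = (1 - (s : ℂ) * z) ^ (c - 1) * (s : ℂ) ^ (-c) * (1 - z) ^ (-c) := by
  have hre : z.re < 1 := (Complex.re_le_norm z).trans_lt hz
  have hx : 0 < (1 - z).re := by simpa using hre
  have hy : 0 < (1 - (s : ℂ) * z).re := by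
    simp only [Complex.sub_re, Complex.one_re, Complex.re_ofReal_mul]
    nlinarith
  have hx0 : 1 - z ≠ 0 := fun h => by simp [h] at hx
  have hy0 : 1 - (s : ℂ) * z ≠ 0 := fun h => by simp [h] at hy
  have hden : (((1 - s : ℝ) : ℂ) - 1) * z + 1 = 1 - (s : ℂ) * z := by
    push_cast
    ring
  have hphi : 1 - phiT (1 - s) z = (s : ℂ) * ((1 - z) / (1 - (s : ℂ) * z)) := by
    rw [phiT, hden]
    push_cast
    field_simp
    ring
  rw [hphi, omegaT, hden, ofReal_mul_cpow hs0 (div_ne_zero hx0 hy0),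
    div_cpow_of_re_pos hx hy, neg_neg, Complex.cpow_sub _ _ hy0, Complex.cpow_one]
  ring

theorem hilbert_falpha_eq (α : ℝ) (hα0 : 0 < α) (hα1 : α < 1)
    (z : ℂ) (hz : z ∈ Metric.ball (0:ℂ) 1) :
    (∫ t in (0:ℝ)..1, omegaT t z * (1 - phiT t z) ^ (-(α:ℂ)))
      = (∫ s in (0:ℝ)..1, (1 - (s:ℂ) * z) ^ ((α:ℂ) - 1) * (s:ℂ) ^ (-(α:ℂ)))
        * (1 - z) ^ (-(α:ℂ)) := by
  have hz' : ‖z‖ < 1 := mem_ball_zero_iff.mp hz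
  have hreflect := intervalIntegral.integral_comp_sub_left (a := 0) (b := 1)
    (fun t : ℝ => omegaT t z * (1 - phiT t z) ^ (-(α : ℂ))) 1
  rw [sub_self, sub_zero] at hreflect
  rw [← hreflect, ← intervalIntegral.integral_mul_const]
  exact intervalIntegral.integral_congr_Ioo_of_le zero_le_one fun s hs =>
    omegaT_mul_one_sub_phiT_cpow hz' hs.1 hs.2 α
end

section
/- Let 1/2 < α < 1 and 0 < t < 1, and set x₀ = (α + 2αt - t - √(4α²t - 2αt + α² - 2α + 1))/(2α - 1). Then x₀ > 0, and x₀ ≤ 1 - t if and only if t ≤ (3α - 2)/(4α - 2). -/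
theorem x0_pos_and_le (α t : ℝ) (hα0 : 1 / 2 < α) (hα1 : α < 1) (ht0 : 0 < t) (ht1 : t < 1) :
    0 < (α + 2 * α * t - t - Real.sqrt (4 * α ^ 2 * t - 2 * α * t + α ^ 2 - 2 * α + 1))
          / (2 * α - 1) ∧
    ((α + 2 * α * t - t - Real.sqrt (4 * α ^ 2 * t - 2 * α * t + α ^ 2 - 2 * α + 1))
          / (2 * α - 1) ≤ 1 - t
      ↔ t ≤ (3 * α - 2) / (4 * α - 2)) := by
  have hc : 0 < 2 * α - 1 := by linarith
  have hct : 0 < (2 * α - 1) * t := mul_pos hc ht0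
  constructor
  · refine div_pos (sub_pos.mpr ((Real.sqrt_lt' (by linarith)).mpr ?_)) hc
    nlinarith [sq_nonneg ((2 * α - 1) * t)]
  · rw [div_le_iff₀ hc, le_div_iff₀ (by linarith : 0 < 4 * α - 2)]
    have h_sqrt := Real.le_sqrt' (x := 1 - α + 2 * ((2 * α - 1) * t))
      (y := 4 * α ^ 2 * t - 2 * α * t + α ^ 2 - 2 * α + 1) (by linarith)
    have h_diff : 4 * α ^ 2 * t - 2 * α * t + α ^ 2 - 2 * α + 1
        - (1 - α + 2 * ((2 * α - 1) * t)) ^ 2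
        = 2 * ((2 * α - 1) * t) * (3 * α - 2 - t * (4 * α - 2)) := by ring
    calc _ ↔ 1 - α + 2 * ((2 * α - 1) * t)
          ≤ √(4 * α ^ 2 * t - 2 * α * t + α ^ 2 - 2 * α + 1) := by
          constructor <;> intro h <;> linarith
      _ ↔ _ := by
          rw [h_sqrt, ← sub_nonneg, h_diff, mul_nonneg_iff_of_pos_left (by linarith), sub_nonneg]
end
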